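/- arXiv:1511.00308 — 3 statements merged into one kernel-verified Lean document; each statement's English description precedes it below -/
import Mathlib

section
/- A pair x, y of unit quaternions satisfies x·y·x⁻¹·y⁻¹ = −1 if and only if re(x) = 0, re(y) = 0, and re(x·y) = 0. -/
open scoped Quaternion

theorem re_eq_zero_of_mul_eq_neg_mul {x y : ℍ[ℝ]} (hy : y ≠ 0) (h : x * y = -(y * x)) :
    x.re = 0 := by
  have hconj : y * x * y⁻¹ = -x := by
    rw [← neg_eq_iff_eq_neg.mpr h, neg_mul, mul_inv_cancel_right₀ hy]
  have hre : (y * x * y⁻¹).re = x.re := by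
    have hcomm (a b : ℍ[ℝ]) : (a * b).re = (b * a).re := by
      simp only [Quaternion.re_mul]
      ring
    rw [hcomm, inv_mul_cancel_left₀ hy]
  rw [hconj, Quaternion.re_neg] at hre
  linarith

theorem mul_eq_neg_mul_iff_re_eq_zero {x y : ℍ[ℝ]} (hx : x ≠ 0) (hy : y ≠ 0) :
    x * y = -(y * x) ↔ x.re = 0 ∧ y.re = 0 ∧ (x * y).re = 0 := by
  constructor
  · intro h
    refine ⟨re_eq_zero_of_mul_eq_neg_mul hy h,
      re_eq_zero_of_mul_eq_neg_mul hx (eq_neg_iff_add_eq_zero.mpr ?_), ?_⟩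
    · rw [h, add_neg_cancel]
    · have hre := congrArg QuaternionAlgebra.re h
      simp only [Quaternion.re_neg, Quaternion.re_mul] at hre ⊢
      linarith
  · rintro ⟨hxr, hyr, hxy⟩
    rw [Quaternion.re_mul] at hxy
    ext <;> simp [hxr, hyr] at hxy ⊢ <;> linarith

/-- A pair of unit quaternions `x`, `y` satisfies `x * y * x⁻¹ * y⁻¹ = -1` iff
`re x = 0`, `re y = 0` and `re (x * y) = 0`. -/
theorem commutator_eq_neg_one_iff (x y : ℍ[ℝ]) (hx : ‖x‖ = 1) (hy : ‖y‖ = 1) :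
    x * y * x⁻¹ * y⁻¹ = -1 ↔ x.re = 0 ∧ y.re = 0 ∧ (x * y).re = 0 := by
  have hx0 : x ≠ 0 := norm_ne_zero_iff.mp (by simp [hx])
  have hy0 : y ≠ 0 := norm_ne_zero_iff.mp (by simp [hy])
  rw [← mul_eq_neg_mul_iff_re_eq_zero hx0 hy0, mul_inv_eq_iff_eq_mul₀ hy0,
    mul_inv_eq_iff_eq_mul₀ hx0, neg_one_mul, neg_mul]
end

section
/- Let n ≥ 1 and let a₁,…,aₙ, b₁,…,bₙ be unit quaternions with re(aᵢ) = 0 and re(bᵢ) = 0 for all i, and with ordered product ∏ᵢ aᵢ·bᵢ⁻¹ = 1. Then there exist unit quaternions d₁,…,dₙ such that dᵢ·aᵢ·dᵢ⁻¹ = bᵢ for all i and the ordered product of commutators ∏ᵢ aᵢ·dᵢ·aᵢ⁻¹·dᵢ⁻¹ equals 1. (Every traceless representation of the 2n-punctured sphere group extends to a representation of the genus-n surface group.) -/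
open scoped Quaternion

lemma Quaternion.mul_self_eq_neg_one_of_re_eq_zero {a : ℍ[ℝ]} (h : ‖a‖ = 1) (hr : a.re = 0) :
    a * a = -1 := by
  have := Quaternion.sq_eq_neg_normSq.mpr hr
  rw [Quaternion.normSq_eq_norm_mul_self, h] at this
  simpa [sq] using this

/-- An imaginary quaternion anticommutes with any imaginary quaternion orthogonal to it. -/
lemma Quaternion.mul_eq_neg_mul_of_orthogonal {a d : ℍ[ℝ]} (ha : a.re = 0) (hd : d.re = 0)
    (h : a.imI * d.imI + a.imJ * d.imJ + a.imK * d.imK = 0) : d * a = -a * d := by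
  ext <;>
    simp only [re_mul, imI_mul, imJ_mul, imK_mul, re_neg, imI_neg, imJ_neg, imK_neg, ha, hd] <;>
    linarith

lemma Quaternion.exists_ne_zero_mul_eq_neg_mul {a : ℍ[ℝ]} (ha : a.re = 0) :
    ∃ d : ℍ[ℝ], d ≠ 0 ∧ d * a = -a * d := by
  by_cases h : a.imI = 0 ∧ a.imJ = 0
  · refine ⟨⟨0, 1, 0, 0⟩, fun h0 => ?_, mul_eq_neg_mul_of_orthogonal ha rfl (by simp [h.1])⟩
    simpa using congrArg QuaternionAlgebra.imI h0
  · refine ⟨⟨0, -a.imJ, a.imI, 0⟩, fun h0 => h ⟨?_, ?_⟩,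
      mul_eq_neg_mul_of_orthogonal ha rfl (by simp; ring)⟩
    · simpa using congrArg QuaternionAlgebra.imJ h0
    · simpa using congrArg QuaternionAlgebra.imI h0

/-- Any two imaginary unit quaternions are conjugate by a unit quaternion. -/
lemma Quaternion.exists_norm_eq_one_conj_eq {a b : ℍ[ℝ]} (ha : ‖a‖ = 1) (hb : ‖b‖ = 1)
    (har : a.re = 0) (hbr : b.re = 0) : ∃ d : ℍ[ℝ], ‖d‖ = 1 ∧ d * a * d⁻¹ = b := by
  obtain ⟨d, hd, hda⟩ : ∃ d : ℍ[ℝ], d ≠ 0 ∧ d * a = b * d := by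
    by_cases h : a + b = 0
    · rw [← neg_eq_of_add_eq_zero_right h]
      exact exists_ne_zero_mul_eq_neg_mul har
    · refine ⟨a + b, h, ?_⟩
      rw [add_mul, mul_add, mul_self_eq_neg_one_of_re_eq_zero ha har,
        mul_self_eq_neg_one_of_re_eq_zero hb hbr, add_comm]
  have hu : ‖(‖d‖⁻¹ • d)‖ = 1 := by
    rw [norm_smul, norm_inv, norm_norm, inv_mul_cancel₀ (norm_ne_zero_iff.mpr hd)]
  have hu0 : ‖d‖⁻¹ • d ≠ 0 := norm_ne_zero_iff.mp (by rw [hu]; exact one_ne_zero)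
  refine ⟨‖d‖⁻¹ • d, hu, ?_⟩
  rw [mul_inv_eq_iff_eq_mul₀ hu0, smul_mul_assoc, hda, mul_smul_comm]

/-- Every traceless representation of the `2n`-punctured sphere group extends to a
representation of the genus-`n` surface group: given unit quaternions `aᵢ`, `bᵢ` with
zero real part and ordered product `∏ᵢ aᵢ * bᵢ⁻¹ = 1`, there are unit quaternions `dᵢ`
with `dᵢ * aᵢ * dᵢ⁻¹ = bᵢ` and `∏ᵢ aᵢ * dᵢ * aᵢ⁻¹ * dᵢ⁻¹ = 1`. -/
theorem traceless_rep_extends (n : ℕ) (hn : 1 ≤ n) (a b : Fin n → ℍ[ℝ])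
    (ha : ∀ i, ‖a i‖ = 1) (hb : ∀ i, ‖b i‖ = 1)
    (har : ∀ i, (a i).re = 0) (hbr : ∀ i, (b i).re = 0)
    (hprod : (List.ofFn fun i => a i * (b i)⁻¹).prod = 1) :
    ∃ d : Fin n → ℍ[ℝ], (∀ i, ‖d i‖ = 1) ∧ (∀ i, d i * a i * (d i)⁻¹ = b i) ∧
      (List.ofFn fun i => a i * d i * (a i)⁻¹ * (d i)⁻¹).prod = 1 := by
  choose d hd hconj using fun i =>
    Quaternion.exists_norm_eq_one_conj_eq (ha i) (hb i) (har i) (hbr i)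
  refine ⟨d, hd, hconj, ?_⟩
  rw [← hprod]
  congr 2
  funext i
  rw [← hconj i]
  simp only [mul_inv_rev, inv_inv, mul_assoc]
end

section
/- Fix n ≥ 1. Let 𝒜ₙ be the set of tuples (a₁,…,aₙ,b₁,…,bₙ) of unit quaternions such that (i) all 2n entries pairwise commute, (ii) re(aᵢ) = 0 and re(bᵢ) = 0 for all i, and (iii) the ordered product ∏ᵢ aᵢ·bᵢ⁻¹ equals 1. Declare two such tuples equivalent if some single unit quaternion conjugates every entry of one to the corresponding entry of the other. Then the quotient of 𝒜ₙ by this equivalence relation has exactly 2^(2n−2) elements. (The abelian stratum of the traceless character variety of the 2n-punctured 2-sphere consists of 2^(2n−2) points.) -/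
open scoped Quaternion

/-- Tuples `(a₁,…,aₙ,b₁,…,bₙ)` of unit quaternions whose `2n` entries pairwise commute,
all with zero real part, and with ordered product `∏ᵢ aᵢ * bᵢ⁻¹ = 1`. -/
def AbelianTuple (n : ℕ) : Type :=
  {p : (Fin n → ℍ[ℝ]) × (Fin n → ℍ[ℝ]) //
    (∀ i j, Commute (p.1 i) (p.1 j) ∧ Commute (p.1 i) (p.2 j) ∧
      Commute (p.2 i) (p.2 j)) ∧
    (∀ i, ‖p.1 i‖ = 1 ∧ ‖p.2 i‖ = 1 ∧ (p.1 i).re = 0 ∧ (p.2 i).re = 0) ∧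
    (List.ofFn fun i => p.1 i * (p.2 i)⁻¹).prod = 1}

/-- Two tuples are equivalent when a single unit quaternion conjugates every entry of
one to the corresponding entry of the other. -/
def abelianConjRel (n : ℕ) (x y : AbelianTuple n) : Prop :=
  ∃ g : ℍ[ℝ], ‖g‖ = 1 ∧ (∀ i, g * x.1.1 i * g⁻¹ = y.1.1 i) ∧
    (∀ i, g * x.1.2 i * g⁻¹ = y.1.2 i)

/-- The quaternion `i`. -/
def quaternionI : ℍ[ℝ] := ⟨0, 1, 0, 0⟩

@[simp] theorem quaternionI_re : quaternionI.re = 0 := rfl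

@[simp] theorem quaternionI_imI : quaternionI.imI = 1 := rfl

@[simp] theorem quaternionI_imJ : quaternionI.imJ = 0 := rfl

@[simp] theorem quaternionI_imK : quaternionI.imK = 0 := rfl

theorem quaternionI_mul_self : quaternionI * quaternionI = -1 := by
  ext <;> simp

theorem norm_quaternionI : ‖quaternionI‖ = 1 := by
  rw [← sq_eq_sq₀ (norm_nonneg _) zero_le_one, sq, ← Quaternion.normSq_eq_norm_mul_self,
    Quaternion.normSq_def']
  simp

theorem exists_ne_zero_mul_quaternionI_eq_neg :
    ∃ g : ℍ[ℝ], g ≠ 0 ∧ g * quaternionI = -quaternionI * g := by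
  obtain ⟨g, hr, hi, hj, hk⟩ : ∃ g : ℍ[ℝ], g.re = 0 ∧ g.imI = 0 ∧ g.imJ = 1 ∧ g.imK = 0 :=
    ⟨⟨0, 0, 1, 0⟩, rfl, rfl, rfl, rfl⟩
  refine ⟨g, fun h => ?_, ?_⟩
  · simp [h] at hj
  · ext <;> simp [hr, hi, hj, hk]

/-- The signs `±1`, viewed as quaternions. -/
noncomputable def quaternionSign : ℤˣ →* ℍ[ℝ] :=
  (Int.castRingHom ℍ[ℝ]).toMonoidHom.comp (Units.coeHom ℤ)

theorem quaternionSign_eq (s : ℤˣ) : quaternionSign s = ((s : ℤ) : ℍ[ℝ]) := rfl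

theorem quaternionSign_injective : Function.Injective quaternionSign := by
  intro s t h
  have h := congrArg QuaternionAlgebra.re h
  rw [quaternionSign_eq, quaternionSign_eq, Quaternion.re_intCast, Quaternion.re_intCast] at h
  exact Units.ext (Int.cast_injective h)

theorem quaternionSign_eq_one_or (s : ℤˣ) : quaternionSign s = 1 ∨ quaternionSign s = -1 := by
  rcases Int.units_eq_one_or s with rfl | rfl <;> simp [quaternionSign_eq]

theorem quaternionSign_commute (s : ℤˣ) (q : ℍ[ℝ]) : Commute (quaternionSign s) q := by
  rw [quaternionSign_eq]
  exact Int.cast_commute _ _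

theorem quaternionSign_mul_inv (s t : ℤˣ) {u : ℍ[ℝ]} (hu : u ≠ 0) :
    quaternionSign s * u * (quaternionSign t * u)⁻¹ = quaternionSign (s * t) := by
  rw [mul_inv_rev, mul_assoc, mul_inv_cancel_left₀ hu, map_mul]
  rcases quaternionSign_eq_one_or t with h | h <;> simp [h, inv_neg]

theorem prod_ofFn_quaternionSign_mul_inv {n : ℕ} (s t : Fin n → ℤˣ) {u : ℍ[ℝ]} (hu : u ≠ 0) :
    (List.ofFn fun i => quaternionSign (s i) * u * (quaternionSign (t i) * u)⁻¹).prod =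
      quaternionSign (∏ i, s i * t i) := by
  simp_rw [quaternionSign_mul_inv _ _ hu]
  rw [← List.prod_ofFn, map_list_prod, List.map_ofFn]
  rfl

theorem Quaternion.mul_self_of_re_eq_zero {u : ℍ[ℝ]} (hu : ‖u‖ = 1) (hre : u.re = 0) :
    u * u = -1 := by
  have h := Quaternion.self_mul_star u
  rw [Quaternion.normSq_eq_norm_mul_self, hu, Quaternion.star_eq_neg.mpr hre] at h
  rw [← neg_eq_iff_eq_neg, ← mul_neg, h]
  simp

theorem exists_eq_quaternionSign_mul {u v : ℍ[ℝ]} (hu : ‖u‖ = 1) (hure : u.re = 0) (hv : ‖v‖ = 1)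
    (hvre : v.re = 0) (h : Commute u v) : ∃ s : ℤˣ, v = quaternionSign s * u := by
  have huv : v * v = u * u := by
    rw [Quaternion.mul_self_of_re_eq_zero hu hure, Quaternion.mul_self_of_re_eq_zero hv hvre]
  rcases h.symm.mul_self_eq_mul_self_iff.mp huv with h | h
  · exact ⟨1, by simp [h]⟩
  · exact ⟨-1, by simp [h, quaternionSign_eq]⟩

theorem Quaternion.re_mul_comm (p q : ℍ[ℝ]) : (p * q).re = (q * p).re := by
  simp only [Quaternion.re_mul]
  ring

theorem Quaternion.re_conj {g : ℍ[ℝ]} (hg : g ≠ 0) (q : ℍ[ℝ]) : (g * q * g⁻¹).re = q.re := by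
  rw [Quaternion.re_mul_comm, inv_mul_cancel_left₀ hg]

/-- Any two purely imaginary unit quaternions are conjugate by a unit quaternion;
here one of them is `i`. -/
theorem exists_conj_eq {u : ℍ[ℝ]} (hu : ‖u‖ = 1) (hre : u.re = 0) :
    ∃ g : ℍ[ℝ], ‖g‖ = 1 ∧ g * quaternionI * g⁻¹ = u := by
  have huu := Quaternion.mul_self_of_re_eq_zero hu hre
  obtain ⟨g, hg, hgI⟩ : ∃ g : ℍ[ℝ], g ≠ 0 ∧ g * quaternionI = u * g := by
    by_cases h : 1 - u * quaternionI = 0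
    · have hu' : u = -quaternionI := by
        have h1 : u * quaternionI = 1 := (sub_eq_zero.mp h).symm
        have h2 : u * quaternionI * quaternionI = quaternionI := by rw [h1, one_mul]
        rw [mul_assoc, quaternionI_mul_self, mul_neg, mul_one] at h2
        rw [← h2, neg_neg]
      rw [hu']
      exact exists_ne_zero_mul_quaternionI_eq_neg
    · refine ⟨1 - u * quaternionI, h, ?_⟩
      rw [sub_mul, mul_sub, mul_assoc, quaternionI_mul_self, ← mul_assoc, huu]
      simp [add_comm]
  have hn : ‖g‖ ≠ 0 := norm_ne_zero_iff.mpr hg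
  refine ⟨‖g‖⁻¹ • g, by rw [norm_smul, norm_inv, norm_norm, inv_mul_cancel₀ hn], ?_⟩
  rw [mul_inv_eq_iff_eq_mul₀ (smul_ne_zero (inv_ne_zero hn) hg), smul_mul_assoc,
    mul_smul_comm, hgI]

/-- The tuple all of whose entries are `± i`, with prescribed signs. -/
noncomputable def signTuple {n : ℕ} (s t : Fin n → ℤˣ) (h : ∏ i, s i * t i = 1) :
    AbelianTuple n :=
  ⟨(fun i => quaternionSign (s i) * quaternionI, fun i => quaternionSign (t i) * quaternionI), by
    have hc (a b : ℤˣ) (u : ℍ[ℝ]) : Commute (quaternionSign a * u) (quaternionSign b * u) :=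
      ((quaternionSign_commute a _).mul_left
        ((quaternionSign_commute b u).symm.mul_right (Commute.refl u)))
    have hs (a : ℤˣ) : ‖quaternionSign a * quaternionI‖ = 1 ∧
        (quaternionSign a * quaternionI).re = 0 := by
      rcases quaternionSign_eq_one_or a with h | h <;> simp [h, norm_quaternionI]
    refine ⟨fun i j => ⟨hc _ _ _, hc _ _ _, hc _ _ _⟩,
      fun i => ⟨(hs _).1, (hs _).1, (hs _).2, (hs _).2⟩, ?_⟩
    refine (prod_ofFn_quaternionSign_mul_inv s t ?_).trans (by rw [h, map_one])
    exact norm_ne_zero_iff.mp (norm_quaternionI ▸ one_ne_zero)⟩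

/-- Every tuple is conjugate to a tuple of signs times `i`, whose first sign is `1`. -/
theorem exists_signTuple_rel {m : ℕ} (x : AbelianTuple (m + 1)) :
    ∃ (s t : Fin (m + 1) → ℤˣ) (h : ∏ i, s i * t i = 1), s 0 = 1 ∧
      abelianConjRel (m + 1) (signTuple s t h) x := by
  obtain ⟨⟨a, b⟩, hc, hn, hp⟩ := x
  dsimp only at hc hn hp
  have hu0 : a 0 ≠ 0 := norm_ne_zero_iff.mp ((hn 0).1 ▸ one_ne_zero)
  choose s hs using fun i =>
    exists_eq_quaternionSign_mul (hn 0).1 (hn 0).2.2.1 (hn i).1 (hn i).2.2.1 (hc 0 i).1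
  choose t ht using fun i =>
    exists_eq_quaternionSign_mul (hn 0).1 (hn 0).2.2.1 (hn i).2.1 (hn i).2.2.2 (hc 0 i).2.1
  have hprod : ∏ i, s i * t i = 1 := by
    apply quaternionSign_injective
    rw [map_one, ← prod_ofFn_quaternionSign_mul_inv s t hu0, ← hp]
    simp_rw [← hs, ← ht]
  obtain ⟨g, hg, hgu⟩ := exists_conj_eq (hn 0).1 (hn 0).2.2.1
  have hconj (r : ℤˣ) : g * (quaternionSign r * quaternionI) * g⁻¹ = quaternionSign r * a 0 := by
    rw [← mul_assoc, ← (quaternionSign_commute r g).eq, mul_assoc, mul_assoc, ← mul_assoc g, hgu]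
  refine ⟨s, t, hprod, ?_, g, hg, fun i => (hconj _).trans (hs i).symm,
    fun i => (hconj _).trans (ht i).symm⟩
  apply quaternionSign_injective
  rw [map_one]
  exact mul_right_cancel₀ hu0 ((hs 0).symm.trans (one_mul _).symm)

/-- The real parts of the products of the first entry with all entries determine
the signs of a tuple up to a global sign and are invariant under conjugation. -/
noncomputable def reInvariant (m : ℕ) :
    Quot (abelianConjRel (m + 1)) → (Fin (m + 1) → ℝ) × (Fin (m + 1) → ℝ) :=
  Quot.lift (fun x => (fun i => (x.1.1 0 * x.1.1 i).re, fun i => (x.1.1 0 * x.1.2 i).re)) (by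
    rintro x y ⟨g, hg, ha, hb⟩
    have hg0 : g ≠ 0 := norm_ne_zero_iff.mp (hg ▸ one_ne_zero)
    have key (p q : ℍ[ℝ]) : (p * q).re = ((g * p * g⁻¹) * (g * q * g⁻¹)).re := by
      have h : g * (p * q) * g⁻¹ = (g * p * g⁻¹) * (g * q * g⁻¹) := by
        simp only [mul_assoc, inv_mul_cancel_left₀ hg0]
      rw [← h, Quaternion.re_conj hg0]
    ext i
    · simp only [← ha, ← key]
    · simp only [← ha, ← hb, ← key])

theorem reInvariant_signTuple {m : ℕ} (s t : Fin (m + 1) → ℤˣ) (h : ∏ i, s i * t i = 1)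
    (h0 : s 0 = 1) :
    reInvariant m (Quot.mk _ (signTuple s t h)) =
      (fun i => -((s i : ℤ) : ℝ), fun i => -((t i : ℤ) : ℝ)) := by
  have key (r : ℤˣ) :
      (quaternionI * (quaternionSign r * quaternionI)).re = -((r : ℤ) : ℝ) := by
    rcases Int.units_eq_one_or r with rfl | rfl <;> simp [quaternionSign_eq]
  ext i <;> simp only [reInvariant, signTuple, h0, map_one, one_mul, key]

theorem prod_cons_mul_cons {m : ℕ} (e d : Fin m → ℤˣ) :
    ∏ i, (Fin.cons 1 e : Fin (m + 1) → ℤˣ) i *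
      (Fin.cons (∏ i, e i * d i) d : Fin (m + 1) → ℤˣ) i = 1 := by
  simp [Fin.prod_univ_succ, Int.units_mul_self]

/-- Classes of tuples are parametrized by the signs of all but the first pair of entries. -/
noncomputable def classOfSigns (m : ℕ) (p : (Fin m → ℤˣ) × (Fin m → ℤˣ)) :
    Quot (abelianConjRel (m + 1)) :=
  Quot.mk _ (signTuple _ _ (prod_cons_mul_cons p.1 p.2))

theorem classOfSigns_bijective (m : ℕ) : Function.Bijective (classOfSigns m) := by
  constructor
  · rintro ⟨e, d⟩ ⟨e', d'⟩ h
    have h := congrArg (reInvariant m) h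
    simp only [classOfSigns] at h
    rw [reInvariant_signTuple _ _ _ rfl, reInvariant_signTuple _ _ _ rfl, Prod.mk.injEq] at h
    ext i
    · simpa using congrFun h.1 i.succ
    · simpa using congrFun h.2 i.succ
  · rintro ⟨x⟩
    obtain ⟨s, t, h, h0, hx⟩ := exists_signTuple_rel x
    have hs : Fin.cons 1 (Fin.tail s) = s := by rw [← h0, Fin.cons_self_tail]
    have ht : Fin.cons (∏ i, Fin.tail s i * Fin.tail t i) (Fin.tail t) = t := by
      rw [Fin.prod_univ_succ, h0, one_mul] at h
      conv_rhs => rw [← Fin.cons_self_tail t, eq_inv_of_mul_eq_one_left h, Int.units_inv_eq_self]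
      rfl
    refine ⟨(Fin.tail s, Fin.tail t), Eq.trans ?_ (Quot.sound hx)⟩
    simp only [classOfSigns, hs, ht]

/-- The abelian stratum of the traceless character variety of the `2n`-punctured
`2`-sphere consists of exactly `2 ^ (2n - 2)` points. -/
theorem abelian_stratum_card (n : ℕ) (hn : 1 ≤ n) :
    Nat.card (Quot (abelianConjRel n)) = 2 ^ (2 * n - 2) := by
  obtain ⟨m, rfl⟩ : ∃ m, n = m + 1 := ⟨n - 1, by omega⟩
  rw [← Nat.card_eq_of_bijective _ (classOfSigns_bijective m), Nat.card_eq_fintype_card]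
  simp only [Fintype.card_prod, Fintype.card_fun, Fintype.card_units_int, Fintype.card_fin]
  rw [← pow_add]
  congr 1
  omega
end
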